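/- Let σ > 0, y > 0, ε ∈ (0,1) and x > 0. Define PU(x) := inf_{λ>0} exp(−λx + λ²(1−ε)σ²/2 + ((e^{λy}−1−λy)/y²)·εσ²), EN_{s²}(u) := exp(−u²/(2s²)), and BH_{s²,y}(u) := exp(−(s²/y²)·ψ(uy/s²)) with ψ(v) := (1+v)·ln(1+v) − v. Then PU(x) = max_{α ∈ (0,1)} EN_{(1−ε)σ²}((1−α)x)·BH_{εσ²,y}(αx), the maximum being attained at the unique root α_x ∈ (0,1) of the equation (1−α)x²/((1−ε)σ²) − (x/y)·ln(1 + αxy/(εσ²)) = 0; moreover α_x ∈ (ε,1) for every x > 0, and α_x is strictly increasing in x with α_x → ε as x → 0 and α_x → 1 as x → ∞. -/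

import Mathlib

open MeasureTheory Real Filter

/-- `ψ(v) = (1+v)ln(1+v) - v`. -/
noncomputable def psiBH (v : ℝ) : ℝ := (1 + v) * Real.log (1 + v) - v

/-- The best exponential bound on a normal tail: `EN_{s²}(u) = exp(-u²/(2s²))`. -/
noncomputable def EN (s2 u : ℝ) : ℝ := Real.exp (-(u ^ 2) / (2 * s2))

/-- The Bennett–Hoeffding bound `BH_{s²,y}(u) = exp(-(s²/y²) ψ(uy/s²))`. -/
noncomputable def BH (s2 y u : ℝ) : ℝ := Real.exp (-(s2 / y ^ 2) * psiBH (u * y / s2))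

/-- The Pinelis–Utev bound `PU(x) = inf_{λ>0} exp(-λx + λ²(1-ε)σ²/2 + ((e^{λy}-1-λy)/y²)εσ²)`. -/
noncomputable def PU (σ y ε x : ℝ) : ℝ :=
  ⨅ l : Set.Ioi (0 : ℝ),
    Real.exp (-(l : ℝ) * x + (l : ℝ) ^ 2 * (1 - ε) * σ ^ 2 / 2 +
      (Real.exp ((l : ℝ) * y) - 1 - (l : ℝ) * y) / y ^ 2 * (ε * σ ^ 2))

/-- The stationarity equation says that `t = (1-a)xy/p` satisfies `e^t = 1 + axy/q`. -/
theorem exp_eq_of_stationary {p q x y a : ℝ} (hp : 0 < p) (hq : 0 < q) (hx : 0 < x) (hy : 0 < y)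
    (ha : 0 < a) (h : (1 - a) * x ^ 2 / p - (x / y) * Real.log (1 + a * x * y / q) = 0) :
    Real.exp ((1 - a) * x * y / p) = 1 + a * x * y / q := by
  have hlog : (1 - a) * x * y / p = Real.log (1 + a * x * y / q) := by
    have h' : x / y * ((1 - a) * x * y / p) = x / y * Real.log (1 + a * x * y / q) := by
      rw [← sub_eq_zero.1 h]
      field_simp
    exact mul_left_cancel₀ (by positivity) h'
  rw [hlog, Real.exp_log (by positivity)]

theorem stationary_root_unique {p q x y a b : ℝ} (hp : 0 < p) (hq : 0 < q) (hx : 0 < x)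
    (hy : 0 < y) (ha : Real.exp ((1 - a) * x * y / p) = 1 + a * x * y / q)
    (hb : Real.exp ((1 - b) * x * y / p) = 1 + b * x * y / q) : a = b := by
  have key : ∀ {c d : ℝ}, Real.exp ((1 - c) * x * y / p) = 1 + c * x * y / q →
      Real.exp ((1 - d) * x * y / p) = 1 + d * x * y / q → d ≤ c := by
    intro c d hc hd
    by_contra! hcd
    have h1 : (1 - d) * x * y / p < (1 - c) * x * y / p := by gcongr
    have h2 : c * x * y / q < d * x * y / q := by gcongr
    have h3 := Real.exp_lt_exp.2 h1
    linarith
  exact le_antisymm (key hb ha) (key ha hb)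

/-- Young's inequality for the pair `e^t - 1 - t`, `ψ`. -/
theorem neg_psiBH_le {t v : ℝ} (hv : 0 < 1 + v) :
    -psiBH v ≤ -t * v + (Real.exp t - 1 - t) := by
  have h := mul_le_mul_of_nonneg_left (Real.add_one_le_exp (t - Real.log (1 + v))) hv.le
  rw [Real.exp_sub, Real.exp_log hv, mul_div_cancel₀ _ hv.ne'] at h
  unfold psiBH
  linarith

theorem neg_psiBH_eq {t v : ℝ} (h : Real.exp t = 1 + v) :
    -psiBH v = -t * v + (Real.exp t - 1 - t) := by
  rw [psiBH, ← h, Real.log_exp, h]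
  ring

theorem EN_mul_BH_le {p q x y a l : ℝ} (hp : 0 < p) (hq : 0 < q) (hx : 0 < x) (hy : 0 < y)
    (ha : 0 < a) :
    EN p ((1 - a) * x) * BH q y (a * x) ≤
      Real.exp (-l * x + l ^ 2 * p / 2 + (Real.exp (l * y) - 1 - l * y) / y ^ 2 * q) := by
  rw [EN, BH, ← Real.exp_add, Real.exp_le_exp]
  have h1 : -((1 - a) * x) ^ 2 / (2 * p) ≤ -l * ((1 - a) * x) + l ^ 2 * p / 2 := by
    rw [div_le_iff₀ (by positivity)]
    nlinarith [sq_nonneg ((1 - a) * x - l * p)]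
  have h2 := mul_le_mul_of_nonneg_left
    (neg_psiBH_le (t := l * y) (v := a * x * y / q) (by positivity))
    (show 0 ≤ q / y ^ 2 by positivity)
  have h3 : q / y ^ 2 * (-(l * y) * (a * x * y / q) + (Real.exp (l * y) - 1 - l * y)) =
      -l * (a * x) + (Real.exp (l * y) - 1 - l * y) / y ^ 2 * q := by
    field_simp
  linarith

theorem EN_mul_BH_eq {p q x y a : ℝ} (hp : 0 < p) (hq : 0 < q) (hy : 0 < y)
    (h : Real.exp ((1 - a) * x * y / p) = 1 + a * x * y / q) :
    EN p ((1 - a) * x) * BH q y (a * x) =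
      Real.exp (-((1 - a) * x / p) * x + ((1 - a) * x / p) ^ 2 * p / 2 +
        (Real.exp ((1 - a) * x / p * y) - 1 - (1 - a) * x / p * y) / y ^ 2 * q) := by
  rw [EN, BH, ← Real.exp_add, Real.exp_eq_exp]
  have h2 := neg_psiBH_eq h
  rw [neg_mul_comm, h2, show (1 - a) * x / p * y = (1 - a) * x * y / p by ring]
  generalize Real.exp ((1 - a) * x * y / p) = E
  field_simp
  ring

theorem ratio_lt_of_exp_eq {p q x y a : ℝ} (hp : 0 < p) (hq : 0 < q) (hx : 0 < x) (hy : 0 < y)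
    (ha : a < 1) (h : Real.exp ((1 - a) * x * y / p) = 1 + a * x * y / q) :
    (1 - a) * q < a * p := by
  have ht : (1 - a) * x * y / p ≠ 0 := by
    have : 0 < 1 - a := sub_pos.2 ha
    positivity
  have h1 := Real.add_one_lt_exp ht
  rw [h] at h1
  have h2 : (1 - a) * x * y / p < a * x * y / q := by linarith
  rw [div_lt_div_iff₀ hp hq] at h2
  have hxy : 0 < x * y := by positivity
  exact lt_of_mul_lt_mul_left (by linarith) hxy.le

theorem root_lt_of_lt {p q x₁ x₂ y a b : ℝ} (hp : 0 < p) (hq : 0 < q) (hx : 0 < x₁)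
    (hxx : x₁ < x₂) (hy : 0 < y) (ha : a < 1)
    (h₁ : Real.exp ((1 - a) * x₁ * y / p) = 1 + a * x₁ * y / q)
    (h₂ : Real.exp ((1 - b) * x₂ * y / p) = 1 + b * x₂ * y / q) : a < b := by
  by_contra! hba
  have ha' : 0 < 1 - a := sub_pos.2 ha
  have hb' : 0 < 1 - b := by linarith
  have hx₂ : 0 < x₂ := hx.trans hxx
  have hlt : (1 - a) * x₁ * y / p < (1 - b) * x₂ * y / p := by
    have : (1 - a) * x₁ < (1 - b) * x₂ := by nlinarith
    gcongr
  have hs := strictConvexOn_exp.secant_strict_mono (Set.mem_univ 0)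
    (Set.mem_univ ((1 - a) * x₁ * y / p)) (Set.mem_univ ((1 - b) * x₂ * y / p))
    (by positivity) (by positivity) hlt
  rw [h₁, h₂, Real.exp_zero, sub_zero, sub_zero, add_sub_cancel_left, add_sub_cancel_left,
    div_div_div_eq, div_div_div_eq, div_lt_div_iff₀ (by positivity) (by positivity)] at hs
  have hc : 0 < x₁ * y * p * (q * (x₂ * y)) := by positivity
  have : a * (1 - b) < b * (1 - a) := lt_of_mul_lt_mul_left (by linarith) hc.le
  linarith

theorem mul_le_of_exp_eq {p q x y a : ℝ} (hp : 0 < p) (hq : 0 < q) (hx : 0 < x) (hy : 0 < y)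
    (ha0 : 0 < a) (ha : a < 1) (h : Real.exp ((1 - a) * x * y / p) = 1 + a * x * y / q) :
    a * p ≤ (1 - a) * q * Real.exp (x * y / p) := by
  have ha' : 0 < 1 - a := sub_pos.2 ha
  set t := (1 - a) * x * y / p with ht
  have htx : t ≤ x * y / p := by
    rw [ht]
    have : (1 - a) * x ≤ x := by nlinarith
    gcongr
  have h1 : Real.exp t - 1 ≤ t * Real.exp t := by
    have h3 := mul_le_mul_of_nonneg_right (Real.add_one_le_exp (-t)) (Real.exp_pos t).le
    rw [← Real.exp_add, neg_add_cancel, Real.exp_zero] at h3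
    linarith
  have h4 : a * x * y / q ≤ (1 - a) * x * y / p * Real.exp (x * y / p) := by
    calc a * x * y / q = Real.exp t - 1 := by rw [h]; ring
      _ ≤ t * Real.exp t := h1
      _ ≤ _ := by
        have : 0 < t := by positivity
        gcongr
  rw [div_mul_eq_mul_div, div_le_div_iff₀ hq hp] at h4
  have hxy : 0 < x * y := by positivity
  exact le_of_mul_le_mul_left (by linarith) hxy

theorem one_sub_le_sqrt_of_exp_eq {p q x y a : ℝ} (hp : 0 < p) (hq : 0 < q) (hx : 0 < x)
    (hy : 0 < y) (ha : a < 1) (h : Real.exp ((1 - a) * x * y / p) = 1 + a * x * y / q) :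
    1 - a ≤ Real.sqrt (2 * p ^ 2 / (q * y) / x) := by
  have ha' : 0 < 1 - a := sub_pos.2 ha
  have ht : 0 < (1 - a) * x * y / p := by positivity
  have h1 := Real.quadratic_le_exp_of_nonneg ht.le
  rw [h] at h1
  have h3 : a * x * y / q ≤ x * y / q := by
    have : a * x ≤ x := by nlinarith
    gcongr
  have h2 : ((1 - a) * x * y / p) ^ 2 / 2 ≤ x * y / q := by linarith
  apply Real.le_sqrt_of_sq_le
  calc (1 - a) ^ 2 = ((1 - a) * x * y / p) ^ 2 / 2 * (2 * p ^ 2 / (x * y) ^ 2) := by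
        field_simp
    _ ≤ x * y / q * (2 * p ^ 2 / (x * y) ^ 2) := by gcongr
    _ = _ := by field_simp

/-- `PU(x)` is the maximum over `α ∈ (0,1)` of
`EN_{(1-ε)σ²}((1-α)x) · BH_{εσ²,y}(αx)`, attained at the unique root `α_x ∈ (0,1)` of
`(1-α)x²/((1-ε)σ²) - (x/y)ln(1 + αxy/(εσ²)) = 0`; moreover `α_x ∈ (ε,1)` and `α_x`
increases in `x` from `ε` to `1`. -/
theorem PU_as_max_EN_BH (σ y ε : ℝ) (hσ : 0 < σ) (hy : 0 < y) (hε0 : 0 < ε) (hε1 : ε < 1)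
    (A : ℝ → ℝ)
    (hA : ∀ x : ℝ, 0 < x → A x ∈ Set.Ioo (0 : ℝ) 1 ∧
      (1 - A x) * x ^ 2 / ((1 - ε) * σ ^ 2) -
        (x / y) * Real.log (1 + A x * x * y / (ε * σ ^ 2)) = 0) :
    (∀ x : ℝ, 0 < x → ∀ a ∈ Set.Ioo (0 : ℝ) 1,
      (1 - a) * x ^ 2 / ((1 - ε) * σ ^ 2) -
        (x / y) * Real.log (1 + a * x * y / (ε * σ ^ 2)) = 0 → a = A x) ∧
    (∀ x : ℝ, 0 < x →
      PU σ y ε x = EN ((1 - ε) * σ ^ 2) ((1 - A x) * x) * BH (ε * σ ^ 2) y (A x * x) ∧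
      ∀ a ∈ Set.Ioo (0 : ℝ) 1,
        EN ((1 - ε) * σ ^ 2) ((1 - a) * x) * BH (ε * σ ^ 2) y (a * x) ≤ PU σ y ε x) ∧
    (∀ x : ℝ, 0 < x → ε < A x ∧ A x < 1) ∧
    StrictMonoOn A (Set.Ioi 0) ∧
    Tendsto A (nhdsWithin 0 (Set.Ioi 0)) (nhds ε) ∧
    Tendsto A atTop (nhds 1) := by
  have hp : 0 < (1 - ε) * σ ^ 2 := mul_pos (sub_pos.2 hε1) (by positivity)
  have hq : 0 < ε * σ ^ 2 := by positivity
  have hexp : ∀ x : ℝ, 0 < x → Real.exp ((1 - A x) * x * y / ((1 - ε) * σ ^ 2)) =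
      1 + A x * x * y / (ε * σ ^ 2) := fun x hx =>
    exp_eq_of_stationary hp hq hx hy (hA x hx).1.1 (hA x hx).2
  have hεA : ∀ x : ℝ, 0 < x → ε < A x := by
    intro x hx
    have h := ratio_lt_of_exp_eq hp hq hx hy (hA x hx).1.2 (hexp x hx)
    have : σ ^ 2 * ε < σ ^ 2 * A x := by linarith
    exact lt_of_mul_lt_mul_left this (by positivity)
  have hle : ∀ x : ℝ, 0 < x → ∀ a ∈ Set.Ioo (0 : ℝ) 1,
      EN ((1 - ε) * σ ^ 2) ((1 - a) * x) * BH (ε * σ ^ 2) y (a * x) ≤ PU σ y ε x := by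
    intro x hx a ha
    have : Nonempty (Set.Ioi (0 : ℝ)) := ⟨⟨1, Set.mem_Ioi.2 one_pos⟩⟩
    refine le_ciInf fun l => ?_
    simpa only [mul_assoc] using EN_mul_BH_le (l := l) hp hq hx hy ha.1
  refine ⟨fun x hx a ha h => stationary_root_unique hp hq hx hy
      (exp_eq_of_stationary hp hq hx hy ha.1 h) (hexp x hx),
    fun x hx => ⟨le_antisymm ?_ (hle x hx _ (hA x hx).1), hle x hx⟩,
    fun x hx => ⟨hεA x hx, (hA x hx).1.2⟩,
    fun x₁ hx₁ x₂ hx₂ hxx => root_lt_of_lt hp hq hx₁ hxx hy (hA x₁ hx₁).1.2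
      (hexp x₁ hx₁) (hexp x₂ hx₂), ?_, ?_⟩
  · have hl : 0 < (1 - A x) * x / ((1 - ε) * σ ^ 2) :=
      div_pos (mul_pos (sub_pos.2 (hA x hx).1.2) hx) hp
    rw [EN_mul_BH_eq hp hq hy (hexp x hx), ← mul_assoc _ (1 - ε)]
    exact ciInf_le (f := fun l : Set.Ioi (0 : ℝ) => Real.exp (-(l : ℝ) * x +
        (l : ℝ) ^ 2 * (1 - ε) * σ ^ 2 / 2 +
        (Real.exp ((l : ℝ) * y) - 1 - (l : ℝ) * y) / y ^ 2 * (ε * σ ^ 2)))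
      ⟨0, by rintro _ ⟨l, rfl⟩; exact (Real.exp_pos _).le⟩ ⟨_, hl⟩
  · have hlim : Tendsto (fun x : ℝ => ε * Real.exp (x * y / ((1 - ε) * σ ^ 2)))
        (nhdsWithin 0 (Set.Ioi 0)) (nhds ε) := by
      have hc : Continuous fun x : ℝ => ε * Real.exp (x * y / ((1 - ε) * σ ^ 2)) := by fun_prop
      simpa using (hc.tendsto 0).mono_left nhdsWithin_le_nhds
    refine tendsto_of_tendsto_of_tendsto_of_le_of_le' tendsto_const_nhds hlim ?_ ?_
    · filter_upwards [self_mem_nhdsWithin] with x hx using (hεA x hx).le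
    · filter_upwards [self_mem_nhdsWithin] with x hx
      have h := mul_le_of_exp_eq hp hq hx hy (hA x hx).1.1 (hA x hx).1.2 (hexp x hx)
      have h2 : (1 - A x) * (ε * σ ^ 2) * Real.exp (x * y / ((1 - ε) * σ ^ 2)) ≤
          (1 - ε) * (ε * σ ^ 2) * Real.exp (x * y / ((1 - ε) * σ ^ 2)) := by
        have := (hεA x hx).le
        gcongr
      exact le_of_mul_le_mul_left (by linarith) hp
  · have hlim : Tendsto (fun x : ℝ =>
        1 - Real.sqrt (2 * ((1 - ε) * σ ^ 2) ^ 2 / (ε * σ ^ 2 * y) / x)) atTop (nhds 1) := by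
      have h := (tendsto_const_nhds (x := 2 * ((1 - ε) * σ ^ 2) ^ 2 / (ε * σ ^ 2 * y))).div_atTop
        (tendsto_id (α := ℝ) (x := atTop))
      simpa using h.sqrt.const_sub 1
    refine tendsto_of_tendsto_of_tendsto_of_le_of_le' hlim tendsto_const_nhds ?_ ?_
    · filter_upwards [eventually_gt_atTop 0] with x hx
      have := one_sub_le_sqrt_of_exp_eq hp hq hx hy (hA x hx).1.2 (hexp x hx)
      linarith
    · filter_upwards [eventually_gt_atTop 0] with x hx using (hA x hx).1.2.le
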